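/- Let D be a dyadic grid in ℝ^d, let S ⊆ D be a sparse collection, and let α_1,…,α_m ∈ [0,1) with Σ_{j=1}^m α_j < 1. Then there is a constant c, depending only on d, m and α_1,…,α_m, such that for all locally integrable g_1,…,g_m on ℝ^d and all Q ∈ D: Σ_{Q'∈S, Q'⊆Q} (∏_{j=1}^m ⟨g_j⟩_{1,Q'}^{α_j}) |Q'| ≤ c · (∏_{j=1}^m ⟨g_j⟩_{1,Q}^{α_j}) |Q|. -/

import Mathlib

open MeasureTheory ENNReal Set

noncomputable section

namespace Paper

variable {d m : ℕ}

abbrev Rd (d : ℕ) := Fin d → ℝ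

structure Cube (d : ℕ) where
  corner : Rd d
  side : ℝ
  side_pos : 0 < side

def Cube.set (Q : Cube d) : Set (Rd d) :=
  {x | ∀ i, Q.corner i ≤ x i ∧ x i < Q.corner i + Q.side}

/-- the average `⟨f⟩_{q,Q}` for finite exponent `q`, of an `ℝ≥0∞`-valued function -/
def eAvg (f : Rd d → ℝ≥0∞) (q : ℝ) (Q : Cube d) : ℝ≥0∞ :=
  ((volume Q.set)⁻¹ * ∫⁻ x in Q.set, f x ^ q) ^ (1 / q)

def ofFn (f : Rd d → ℝ) : Rd d → ℝ≥0∞ := fun x => ENNReal.ofReal |f x|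

/-- the average `⟨f⟩_{q,Q}` for finite exponent `q > 0` -/
def avg (f : Rd d → ℝ) (q : ℝ) (Q : Cube d) : ℝ≥0∞ := eAvg (ofFn f) q Q

/-- the average `⟨f⟩_{q,Q}` for exponent `q ∈ (0,∞]` -/
def avgE (f : Rd d → ℝ) (q : ℝ≥0∞) (Q : Cube d) : ℝ≥0∞ :=
  if q = ∞ then essSup (ofFn f) (volume.restrict Q.set) else avg f q.toReal Q

def IsWeight (u : Rd d → ℝ) : Prop :=
  MeasureTheory.LocallyIntegrable u volume ∧ ∀ᵐ x ∂(volume : Measure (Rd d)), 0 < u x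

/-- `u(A) = ∫_A u dx` -/
def wMeas (u : Rd d → ℝ) (A : Set (Rd d)) : ℝ≥0∞ := ∫⁻ x in A, ENNReal.ofReal (u x)

/-- the Hardy–Littlewood maximal operator -/
def maximal (f : Rd d → ℝ) (x : Rd d) : ℝ≥0∞ :=
  ⨆ (Q : Cube d) (_ : x ∈ Q.set), avg f 1 Q

/-- the Fujii–Wilson constant `[u]_FW` -/
def FW (u : Rd d → ℝ) : ℝ≥0∞ :=
  ⨆ Q : Cube d, (wMeas u Q.set)⁻¹ * ∫⁻ x in Q.set, maximal (Q.set.indicator u) x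

/-- Hölder conjugate in `ℝ≥0∞` -/
def conj (q : ℝ≥0∞) : ℝ≥0∞ := (1 - q⁻¹)⁻¹

def prodW (w : Fin m → Rd d → ℝ) : Rd d → ℝ := fun x => ∏ j, w j x

/-- the two-weight multilinear Muckenhoupt constant `[w⃗,ω]_{p⃗}`; here `p0` is the
real number with `1/p0 = ∑ 1/p j`. -/
def APtw (p0 : ℝ) (p : Fin m → ℝ≥0∞) (w : Fin m → Rd d → ℝ) (ω : Rd d → ℝ) : ℝ≥0∞ :=
  ⨆ Q : Cube d, avg ω p0 Q * ∏ j, avgE (fun x => (w j x)⁻¹) (conj (p j)) Q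

/-- the multilinear Muckenhoupt constant `[w⃗]_{p⃗}` -/
def AP (p0 : ℝ) (p : Fin m → ℝ≥0∞) (w : Fin m → Rd d → ℝ) : ℝ≥0∞ :=
  APtw p0 p w (prodW w)

def IsSparse (η : ℝ) (S : Set (Cube d)) : Prop :=
  ∃ E : Cube d → Set (Rd d),
    (∀ Q ∈ S, E Q ⊆ Q.set ∧ MeasurableSet (E Q) ∧
      ENNReal.ofReal η * volume Q.set ≤ volume (E Q)) ∧
    S.PairwiseDisjoint E

def dyadicGrid (d : ℕ) (α : Rd d) : Set (Cube d) :=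
  {Q | ∃ (j : ℤ) (k : Fin d → ℤ),
    Q.side = (2:ℝ) ^ (-j) ∧ ∀ i, Q.corner i = (2:ℝ) ^ (-j) * (α i + k i)}

def IsDyadicGrid (D : Set (Cube d)) : Prop :=
  ∃ α : Rd d, (∀ i, α i = 0 ∨ α i = 1/3 ∨ α i = 2/3) ∧ D = dyadicGrid d α

/-- bounded, compactly supported, measurable -/
def BCS (f : Rd d → ℝ) : Prop :=
  Measurable f ∧ (∃ C, ∀ x, |f x| ≤ C) ∧ HasCompactSupport f

def sparseForm (S : Set (Cube d)) (f : Fin m → Rd d → ℝ) (g : Rd d → ℝ) : ℝ≥0∞ :=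
  ∑' Q : S, (∏ j, avg (f j) 1 Q.1) * avg g 1 Q.1 * volume (Q.1).set

def SparseFormDom (T : (Fin m → Rd d → ℝ) → Rd d → ℝ) (CT : ℝ≥0∞) : Prop :=
  ∀ (f : Fin m → Rd d → ℝ) (g : Rd d → ℝ), (∀ j, BCS (f j)) → BCS g →
    ∃ S : Set (Cube d), IsSparse (1/2) S ∧
      (∫⁻ x, ofFn (T f) x * ofFn g x) ≤ CT * sparseForm S f g

/-- `‖f‖_{L^{p,∞}_u} = sup_{λ>0} λ (u^p({f > λ}))^{1/p}` for `ℝ≥0∞`-valued `f` -/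
def eWeakNorm (u : Rd d → ℝ) (p : ℝ) (f : Rd d → ℝ≥0∞) : ℝ≥0∞ :=
  ⨆ (l : ℝ) (_ : 0 < l), ENNReal.ofReal l *
    (∫⁻ x in {x | ENNReal.ofReal l < f x}, ENNReal.ofReal (u x) ^ p) ^ (1/p)

def weakNorm (u : Rd d → ℝ) (p : ℝ) (f : Rd d → ℝ) : ℝ≥0∞ := eWeakNorm u p (ofFn f)

/-- `‖f‖_{L^p_u} = ‖fu‖_{L^p}` -/
def LpW (u : Rd d → ℝ) (p : ℝ≥0∞) (f : Rd d → ℝ) : ℝ≥0∞ :=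
  eLpNorm (fun x => f x * u x) p volume

theorem Cube.set_eq_pi (Q : Cube d) :
    Q.set = Set.univ.pi fun i => Set.Ico (Q.corner i) (Q.corner i + Q.side) := by
  ext x
  simp [Cube.set]

theorem Cube.measurableSet_set (Q : Cube d) : MeasurableSet Q.set := by
  rw [Q.set_eq_pi]
  exact MeasurableSet.univ_pi fun _ => measurableSet_Ico

theorem Cube.volume_set (Q : Cube d) : volume Q.set = ENNReal.ofReal Q.side ^ d := by
  rw [Q.set_eq_pi, Real.volume_pi_Ico]
  simp

theorem Cube.volume_set_ne_zero (Q : Cube d) : volume Q.set ≠ 0 := by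
  rw [Q.volume_set]
  exact pow_ne_zero _ (by simpa using Q.side_pos)

theorem Cube.volume_set_ne_top (Q : Cube d) : volume Q.set ≠ ∞ := by
  rw [Q.volume_set]
  exact ENNReal.pow_ne_top ENNReal.ofReal_ne_top

theorem Cube.nonempty_set (Q : Cube d) : Q.set.Nonempty :=
  ⟨Q.corner, fun _ => ⟨le_rfl, by linarith [Q.side_pos]⟩⟩

/-- the cube concentric with `Q` of five times the side length -/
def Cube.dilateFive (Q : Cube d) : Cube d where
  corner i := Q.corner i - 2 * Q.side
  side := 5 * Q.side
  side_pos := by linarith [Q.side_pos]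

theorem Cube.volume_dilateFive (Q : Cube d) :
    volume Q.dilateFive.set = 5 ^ d * volume Q.set := by
  rw [Cube.volume_set, Cube.volume_set, ← mul_pow]
  congr 1
  simp [Cube.dilateFive, ENNReal.ofReal_mul]

theorem Cube.set_subset_dilateFive {P Q : Cube d} (h : (P.set ∩ Q.set).Nonempty)
    (hside : P.side ≤ 2 * Q.side) : P.set ⊆ Q.dilateFive.set := by
  obtain ⟨z, hzP, hzQ⟩ := h
  intro x hx i
  have h1 := hx i
  have h2 := hzP i
  have h3 := hzQ i
  simp only [Cube.dilateFive]
  constructor <;> linarith [h1.1, h1.2, h2.1, h2.2, h3.1, h3.2]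

theorem exists_disjoint_subset_volume_biUnion_le {ι : Type*} (T : Finset ι) (B : ι → Cube d) :
    ∃ U ⊆ T, (U : Set ι).PairwiseDisjoint (fun i => (B i).set) ∧
      volume (⋃ i ∈ T, (B i).set) ≤ 5 ^ d * ∑ i ∈ U, volume (B i).set := by
  classical
  obtain ⟨u, huT, hdisj, hcov⟩ := Vitali.exists_disjoint_subfamily_covering_enlargement
    (fun i => (B i).set) (T : Set ι) (fun i => (B i).side) 2 one_lt_two
    (fun i _ => (B i).side_pos.le) (∑ i ∈ T, (B i).side)
    (fun i hi => Finset.single_le_sum (f := fun i => (B i).side)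
      (fun j _ => (B j).side_pos.le) (by simpa using hi))
    (fun i _ => (B i).nonempty_set)
  lift u to Finset ι using T.finite_toSet.subset huT
  refine ⟨u, by exact_mod_cast huT, hdisj, ?_⟩
  have hsub : (⋃ i ∈ T, (B i).set) ⊆ ⋃ i ∈ u, (B i).dilateFive.set := by
    refine Set.iUnion₂_subset fun i hi => ?_
    obtain ⟨b, hb, hne, hside⟩ := hcov i (by simpa using hi)
    exact (Cube.set_subset_dilateFive hne hside).trans
      (Set.subset_biUnion_of_mem (u := fun i => (B i).dilateFive.set) (by simpa using hb))
  calc volume (⋃ i ∈ T, (B i).set) ≤ volume (⋃ i ∈ u, (B i).dilateFive.set) := measure_mono hsub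
    _ ≤ ∑ i ∈ u, volume (B i).dilateFive.set := measure_biUnion_finset_le _ _
    _ = 5 ^ d * ∑ i ∈ u, volume (B i).set := by
      simp_rw [Cube.volume_dilateFive, Finset.mul_sum]

theorem mul_volume_biUnion_le {ι : Type*} (T : Finset ι) (B : ι → Cube d) (ν : Measure (Rd d))
    (l : ℝ≥0∞) {A : Set (Rd d)} (hA : ∀ i ∈ T, (B i).set ⊆ A)
    (hl : ∀ i ∈ T, l * volume (B i).set ≤ ν (B i).set) :
    l * volume (⋃ i ∈ T, (B i).set) ≤ 5 ^ d * ν A := by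
  obtain ⟨U, hUT, hdisj, hU⟩ := exists_disjoint_subset_volume_biUnion_le T B
  calc l * volume (⋃ i ∈ T, (B i).set) ≤ l * (5 ^ d * ∑ i ∈ U, volume (B i).set) := by gcongr
    _ = 5 ^ d * ∑ i ∈ U, l * volume (B i).set := by rw [← Finset.mul_sum]; ring
    _ ≤ 5 ^ d * ∑ i ∈ U, ν (B i).set := by
      gcongr with i hi
      exact hl i (hUT hi)
    _ = 5 ^ d * ν (⋃ i ∈ U, (B i).set) := by
      rw [measure_biUnion_finset hdisj fun i _ => (B i).measurableSet_set]
    _ ≤ 5 ^ d * ν A := by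
      gcongr
      exact Set.iUnion₂_subset fun i hi => hA i (hUT hi)

theorem IsSparse.sum_volume_le {S : Set (Cube d)} (hS : IsSparse (1/2) S) {ι : Type*}
    (T : Finset ι) {B : ι → Cube d} (hB : Function.Injective B) (hBS : ∀ i ∈ T, B i ∈ S) :
    ∑ i ∈ T, volume (B i).set ≤ 2 * volume (⋃ i ∈ T, (B i).set) := by
  obtain ⟨E, hE, hdisj⟩ := hS
  have hhalf : ENNReal.ofReal (1 / 2) = 2⁻¹ := by
    rw [one_div, ENNReal.ofReal_inv_of_pos two_pos, ENNReal.ofReal_ofNat]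
  calc ∑ i ∈ T, volume (B i).set ≤ ∑ i ∈ T, 2 * volume (E (B i)) := by
        refine Finset.sum_le_sum fun i hi => ?_
        have h := (hE _ (hBS i hi)).2.2
        rwa [hhalf, ENNReal.inv_mul_le_iff two_ne_zero ofNat_ne_top] at h
    _ = 2 * volume (⋃ i ∈ T, E (B i)) := by
      rw [← Finset.mul_sum, measure_biUnion_finset _ fun i hi => (hE _ (hBS i hi)).2.1]
      intro i hi j hj hij
      exact hdisj (hBS i hi) (hBS j hj) (hB.ne hij)
    _ ≤ 2 * volume (⋃ i ∈ T, (B i).set) := by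
      gcongr with i hi
      exact (hE _ (hBS i hi)).1

theorem rpow_le_one_add_tsum_ite {x : ℝ≥0∞} (hx : x ≠ ∞) {s : ℝ} (hs : 0 ≤ s) :
    x ^ s ≤ 1 + ∑' k : ℕ, if 2 ^ k < x then ((2 : ℝ≥0∞) ^ s) ^ (k + 1) else 0 := by
  classical
  have hex : ∃ n : ℕ, x ≤ 2 ^ n := by
    lift x to NNReal using hx
    obtain ⟨n, hn⟩ := pow_unbounded_of_one_lt x one_lt_two
    exact ⟨n, by exact_mod_cast hn.le⟩
  have hspec := Nat.find_spec hex
  rcases hn : Nat.find hex with _ | k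
  · rw [hn, pow_zero] at hspec
    exact (ENNReal.rpow_le_one hspec hs).trans le_self_add
  · rw [hn] at hspec
    have hk : 2 ^ k < x := not_le.1 (Nat.find_min hex (by omega))
    calc x ^ s ≤ ((2 : ℝ≥0∞) ^ (k + 1)) ^ s := ENNReal.rpow_le_rpow hspec hs
      _ = ((2 : ℝ≥0∞) ^ s) ^ (k + 1) := by
        rw [← ENNReal.rpow_natCast, ← ENNReal.rpow_natCast, ← ENNReal.rpow_mul,
          ← ENNReal.rpow_mul, mul_comm]
      _ = if 2 ^ k < x then ((2 : ℝ≥0∞) ^ s) ^ (k + 1) else 0 := (if_pos hk).symm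
      _ ≤ _ := (ENNReal.le_tsum k).trans le_add_self

/-- the constant in the Carleson-type embedding for powers of averages -/
def embeddingConst (d m : ℕ) (s : ℝ) : ℝ≥0∞ :=
  2 + 2 * 5 ^ d * m * 2 ^ s * (1 - 2 ^ s * 2⁻¹)⁻¹

theorem embeddingConst_ne_top (d m : ℕ) {s : ℝ} (hs : 0 ≤ s) (hs1 : s < 1) :
    embeddingConst d m s ≠ ∞ := by
  have h2 : (2 : ℝ≥0∞) ^ s ≠ ∞ := ENNReal.rpow_ne_top_of_nonneg hs ofNat_ne_top
  have hlt : (2 : ℝ≥0∞) ^ s * 2⁻¹ < 1 := by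
    rw [← div_eq_mul_inv, ENNReal.div_lt_iff (by simp) (by simp), one_mul]
    simpa using ENNReal.rpow_lt_rpow_of_exponent_lt (x := 2) (by norm_num) ofNat_ne_top hs1
  have hinv : (1 - (2 : ℝ≥0∞) ^ s * 2⁻¹)⁻¹ ≠ ∞ := ENNReal.inv_ne_top.2 (tsub_pos_of_lt hlt).ne'
  unfold embeddingConst
  finiteness

theorem IsSparse.sum_rpow_mul_volume_le {S : Set (Cube d)} (hS : IsSparse (1/2) S) {ι : Type*}
    (T : Finset ι) {B : ι → Cube d} (hB : Function.Injective B) (hBS : ∀ i ∈ T, B i ∈ S)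
    {Q : Cube d} (hQ : ∀ i ∈ T, (B i).set ⊆ Q.set) {ν : Measure (Rd d)} {m : ℕ}
    (hν : ν Q.set ≤ m * volume Q.set) {s : ℝ} (hs : 0 ≤ s) :
    ∑ i ∈ T, ((volume (B i).set)⁻¹ * ν (B i).set) ^ s * volume (B i).set ≤
      embeddingConst d m s * volume Q.set := by
  classical
  set x : ι → ℝ≥0∞ := fun i => (volume (B i).set)⁻¹ * ν (B i).set with hx
  set r : ℝ≥0∞ := 2 ^ s
  have hνtop : ν Q.set ≠ ∞ :=
    ne_top_of_le_ne_top (ENNReal.mul_ne_top (natCast_ne_top m) Q.volume_set_ne_top) hν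
  have hxtop : ∀ i ∈ T, x i ≠ ∞ := fun i hi =>
    ENNReal.mul_ne_top (ENNReal.inv_ne_top.2 (B i).volume_set_ne_zero)
      (measure_ne_top_of_subset (hQ i hi) hνtop)
  have hlevel (k : ℕ) : ∑ i ∈ T with 2 ^ k < x i, volume (B i).set ≤
      2 * 5 ^ d * m * volume Q.set * 2⁻¹ ^ k := by
    have hmem : ∀ i ∈ T.filter (2 ^ k < x ·), i ∈ T := fun i hi => (Finset.mem_filter.1 hi).1
    have hweak := mul_volume_biUnion_le (T.filter (2 ^ k < x ·)) B ν (2 ^ k)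
      (fun i hi => hQ i (hmem i hi)) (fun i hi => by
        have h := (Finset.mem_filter.1 hi).2.le
        rwa [hx, ← ENNReal.mul_le_iff_le_inv (B i).volume_set_ne_zero (B i).volume_set_ne_top,
          mul_comm] at h)
    calc ∑ i ∈ T with 2 ^ k < x i, volume (B i).set
        ≤ 2 * volume (⋃ i ∈ T.filter (2 ^ k < x ·), (B i).set) :=
          hS.sum_volume_le _ hB fun i hi => hBS i (hmem i hi)
      _ ≤ 2 * ((2 ^ k)⁻¹ * (5 ^ d * (m * volume Q.set))) := by
        gcongr
        rw [← ENNReal.mul_le_iff_le_inv (by simp) (by simp)]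
        exact hweak.trans (by gcongr)
      _ = 2 * 5 ^ d * m * volume Q.set * 2⁻¹ ^ k := by
        rw [ENNReal.inv_pow]; ring
  calc ∑ i ∈ T, x i ^ s * volume (B i).set
      ≤ ∑ i ∈ T, (1 + ∑' k : ℕ, if 2 ^ k < x i then r ^ (k + 1) else 0) * volume (B i).set := by
        gcongr with i hi
        exact rpow_le_one_add_tsum_ite (hxtop i hi) hs
    _ = ∑ i ∈ T, volume (B i).set +
        ∑' k : ℕ, r ^ (k + 1) * ∑ i ∈ T with 2 ^ k < x i, volume (B i).set := by
      simp_rw [add_mul, one_mul, Finset.sum_add_distrib, ← ENNReal.tsum_mul_right]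
      rw [← Summable.tsum_finsetSum fun _ _ => ENNReal.summable]
      congr 2 with k
      simp_rw [Finset.mul_sum, Finset.sum_filter, ite_mul, zero_mul]
    _ ≤ 2 * volume Q.set + ∑' k : ℕ, r ^ (k + 1) * (2 * 5 ^ d * m * volume Q.set * 2⁻¹ ^ k) := by
      gcongr with k
      · exact (hS.sum_volume_le T hB hBS).trans (by gcongr; exact Set.iUnion₂_subset hQ)
      · exact hlevel k
    _ = 2 * volume Q.set +
        ∑' k : ℕ, 2 * 5 ^ d * m * volume Q.set * r * (r * 2⁻¹) ^ k := by
      congr 2 with k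
      rw [mul_pow]; ring
    _ = embeddingConst d m s * volume Q.set := by
      rw [ENNReal.tsum_mul_left, ENNReal.tsum_geometric, embeddingConst]
      ring

theorem avg_one (f : Rd d → ℝ) (Q : Cube d) :
    avg f 1 Q = (volume Q.set)⁻¹ * ∫⁻ x in Q.set, ofFn f x := by
  simp [avg, eAvg]

theorem avg_one_ne_top {f : Rd d → ℝ} (hf : LocallyIntegrable f volume) (Q : Cube d) :
    avg f 1 Q ≠ ∞ := by
  have hsub : Q.set ⊆ Set.Icc Q.corner (fun i => Q.corner i + Q.side) :=
    fun x hx => ⟨fun i => (hx i).1, fun i => (hx i).2.le⟩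
  have hint : IntegrableOn f Q.set volume := (hf.integrableOn_isCompact isCompact_Icc).mono_set hsub
  rw [avg_one]
  refine ENNReal.mul_ne_top (ENNReal.inv_ne_top.2 Q.volume_set_ne_zero) ?_
  have h := hint.hasFiniteIntegral
  rw [hasFiniteIntegral_iff_norm] at h
  exact h.ne

theorem setLIntegral_ofFn_eq (f : Rd d → ℝ) (Q : Cube d) :
    ∫⁻ x in Q.set, ofFn f x = avg f 1 Q * volume Q.set := by
  rw [avg_one, mul_comm, ← mul_assoc,
    ENNReal.mul_inv_cancel Q.volume_set_ne_zero Q.volume_set_ne_top, one_mul]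

theorem avg_one_eq_zero_of_subset {f : Rd d → ℝ} {P Q : Cube d} (hPQ : P.set ⊆ Q.set)
    (h : avg f 1 Q = 0) : avg f 1 P = 0 := by
  have hQ := setLIntegral_ofFn_eq f Q
  rw [h, zero_mul] at hQ
  have hP : ∫⁻ x in P.set, ofFn f x = 0 :=
    le_antisymm ((lintegral_mono_set hPQ).trans hQ.le) zero_le
  rw [avg_one, hP, mul_zero]

/-- the measure `∑ⱼ |gⱼ| / ⟨gⱼ⟩_{1,Q} dx` -/
def normalizedMeasure (g : Fin m → Rd d → ℝ) (Q : Cube d) : Measure (Rd d) :=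
  ∑ j, (avg (g j) 1 Q)⁻¹ • volume.withDensity (ofFn (g j))

theorem normalizedMeasure_apply (g : Fin m → Rd d → ℝ) (Q P : Cube d) :
    normalizedMeasure g Q P.set =
      (∑ j, (avg (g j) 1 Q)⁻¹ * avg (g j) 1 P) * volume P.set := by
  simp [normalizedMeasure, withDensity_apply _ P.measurableSet_set, setLIntegral_ofFn_eq,
    Finset.sum_mul, mul_assoc]

theorem normalizedMeasure_self_le (g : Fin m → Rd d → ℝ) (Q : Cube d) :
    normalizedMeasure g Q Q.set ≤ m * volume Q.set := by
  rw [normalizedMeasure_apply]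
  gcongr
  calc ∑ j, (avg (g j) 1 Q)⁻¹ * avg (g j) 1 Q ≤ ∑ _j : Fin m, (1 : ℝ≥0∞) :=
        Finset.sum_le_sum fun j _ => ENNReal.inv_mul_le_one _
    _ = m := by simp

theorem prod_rpow_eq_rpow_sum {ι : Type*} (s : Finset ι) (x : ℝ≥0∞) {α : ι → ℝ}
    (hα : ∀ j ∈ s, 0 ≤ α j) : ∏ j ∈ s, x ^ α j = x ^ ∑ j ∈ s, α j := by
  classical
  induction s using Finset.induction_on with
  | empty => simp
  | insert a s ha ih =>
    rw [Finset.prod_insert ha, Finset.sum_insert ha,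
      ih fun j hj => hα j (Finset.mem_insert_of_mem hj),
      ENNReal.rpow_add_of_nonneg _ _ (hα a (Finset.mem_insert_self a s))
        (Finset.sum_nonneg fun j hj => hα j (Finset.mem_insert_of_mem hj))]

theorem prod_avg_rpow_le {α : Fin m → ℝ} (hα : ∀ j, 0 ≤ α j) {g : Fin m → Rd d → ℝ}
    (hg : ∀ j, LocallyIntegrable (g j) volume) {P Q : Cube d} (hPQ : P.set ⊆ Q.set) :
    ∏ j, avg (g j) 1 P ^ α j ≤ (∏ j, avg (g j) 1 Q ^ α j) *
      ((volume P.set)⁻¹ * normalizedMeasure g Q P.set) ^ ∑ j, α j := by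
  rw [← prod_rpow_eq_rpow_sum _ _ fun j _ => hα j, ← Finset.prod_mul_distrib]
  refine Finset.prod_le_prod' fun j _ => ?_
  rw [← ENNReal.mul_rpow_of_nonneg _ _ (hα j)]
  refine ENNReal.rpow_le_rpow ?_ (hα j)
  by_cases h0 : avg (g j) 1 Q = 0
  · simp [avg_one_eq_zero_of_subset hPQ h0]
  have hvol : (volume P.set)⁻¹ * normalizedMeasure g Q P.set =
      ∑ i, (avg (g i) 1 Q)⁻¹ * avg (g i) 1 P := by
    rw [normalizedMeasure_apply, mul_comm, mul_assoc,
      ENNReal.mul_inv_cancel P.volume_set_ne_zero P.volume_set_ne_top, mul_one]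
  rw [hvol]
  calc avg (g j) 1 P = avg (g j) 1 Q * ((avg (g j) 1 Q)⁻¹ * avg (g j) 1 P) := by
        rw [← mul_assoc, ENNReal.mul_inv_cancel h0 (avg_one_ne_top (hg j) Q), one_mul]
    _ ≤ _ := by
      gcongr
      exact Finset.single_le_sum (f := fun i => (avg (g i) 1 Q)⁻¹ * avg (g i) 1 P)
        (fun _ _ => zero_le) (Finset.mem_univ j)

/-- Lemma: `Σ_{Q'∈S, Q'⊆Q} (∏_j ⟨g_j⟩_{1,Q'}^{α_j}) |Q'| ≲ (∏_j ⟨g_j⟩_{1,Q}^{α_j}) |Q|`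
for sparse `S` in a dyadic grid, `α_j ∈ [0,1)` with `Σ α_j < 1`. -/
theorem stmt6 (d m : ℕ) (hd : 1 ≤ d) (hm : 1 ≤ m)
    (α : Fin m → ℝ) (hα : ∀ j, 0 ≤ α j ∧ α j < 1) (hαsum : ∑ j, α j < 1) :
    ∃ c : ℝ≥0∞, c ≠ ∞ ∧
      ∀ D : Set (Cube d), IsDyadicGrid D →
        ∀ S : Set (Cube d), S ⊆ D → IsSparse (1/2) S →
          ∀ g : Fin m → Rd d → ℝ,
            (∀ j, MeasureTheory.LocallyIntegrable (g j) volume) →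
            ∀ Q ∈ D,
              (∑' Q' : {Q' ∈ S | Cube.set Q' ⊆ Q.set},
                  (∏ j, avg (g j) 1 Q'.1 ^ α j) * volume (Q'.1).set) ≤
                c * (∏ j, avg (g j) 1 Q ^ α j) * volume Q.set := by
  refine ⟨embeddingConst d m (∑ j, α j),
    embeddingConst_ne_top d m (Finset.sum_nonneg fun j _ => (hα j).1) hαsum, ?_⟩
  intro D _ S _ hS g hg Q _
  rw [ENNReal.tsum_eq_iSup_sum]
  refine iSup_le fun T => ?_
  set A := ∏ j, avg (g j) 1 Q ^ α j
  set ν := normalizedMeasure g Q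
  calc ∑ P ∈ T, (∏ j, avg (g j) 1 P.1 ^ α j) * volume P.1.set
      ≤ ∑ P ∈ T, A * ((volume P.1.set)⁻¹ * ν P.1.set) ^ (∑ j, α j) * volume P.1.set := by
        gcongr with P hP
        exact prod_avg_rpow_le (fun j => (hα j).1) hg P.2.2
    _ = A * ∑ P ∈ T, ((volume P.1.set)⁻¹ * ν P.1.set) ^ (∑ j, α j) * volume P.1.set := by
      simp_rw [Finset.mul_sum, mul_assoc]
    _ ≤ A * (embeddingConst d m (∑ j, α j) * volume Q.set) := by
      gcongr
      exact hS.sum_rpow_mul_volume_le T Subtype.val_injective (fun P _ => P.2.1)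
        (fun P _ => P.2.2) (normalizedMeasure_self_le g Q)
        (Finset.sum_nonneg fun j _ => (hα j).1)
    _ = embeddingConst d m (∑ j, α j) * A * volume Q.set := by ring

end Paper
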